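/- Let F_0 = (V, E_0) be a forest with n = |V| vertices and m = |E_0| edges, let p be an integer with 1 ≤ p ≤ n − 1, and let F_i = (V, E_i), 0 ≤ i ≤ l, be a sequence of forests with E_i ⊆ E_{i−1} and |E_i| = |E_{i−1}| − p for 1 ≤ i ≤ l, such that every connected component of F_l has fewer than p edges. If m > n·(p−1)/p, then l ≥ ⌈(1/p)·(m − n·(p−1)/p)⌉. -/

import Mathlib

/-- The edges of the connected component `C` of a graph `G`:
edges of `G` all of whose endpoints belong to `C`. -/
def componentEdges {V : Type*} (G : SimpleGraph V) (C : G.ConnectedComponent) : Set (Sym2 V) :=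
  {e | e ∈ G.edgeSet ∧ ∀ v ∈ e, G.connectedComponentMk v = C}

theorem componentEdges_ncard_add_one_le {V : Type*} [Fintype V] (G : SimpleGraph V)
    (hG : G.IsAcyclic) (C : G.ConnectedComponent) :
    (componentEdges G C).ncard + 1 ≤ C.supp.ncard := by
  classical
  have h := (hG.isTree_connectedComponent C).card_edgeFinset
  have hsub : componentEdges G C ⊆ (Sym2.map Subtype.val) '' (C.toSimpleGraph.edgeSet) := by
    rintro e ⟨he, hv⟩
    induction e using Sym2.ind with
    | _ a b =>
      have ha : a ∈ C.supp := hv a (by simp)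
      have hb : b ∈ C.supp := hv b (by simp)
      refine ⟨s(⟨a, ha⟩, ⟨b, hb⟩), ?_, by simp⟩
      exact he
  have h1 := Set.ncard_le_ncard hsub (Set.toFinite _)
  have h2 := Set.ncard_image_le (f := Sym2.map Subtype.val)
    (Set.toFinite (C.toSimpleGraph.edgeSet))
  have h3 : (C.toSimpleGraph.edgeSet).ncard = C.toSimpleGraph.edgeFinset.card := by
    rw [← SimpleGraph.coe_edgeFinset, Set.ncard_coe_finset]
  have h4 : C.supp.ncard = Fintype.card C.supp := by
    rw [← Nat.card_coe_set_eq, Nat.card_eq_fintype_card]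
  have h5 : Fintype.card C.supp = Fintype.card C := Fintype.card_congr (Equiv.refl _)
  omega

theorem mul_edges_le {V : Type*} [Fintype V] (G : SimpleGraph V) (p : ℕ)
    (hG : G.IsAcyclic) (hlast : ∀ C : G.ConnectedComponent, (componentEdges G C).ncard < p) :
    p * G.edgeSet.ncard + Fintype.card V ≤ p * Fintype.card V := by
  classical
  have hE : G.edgeSet.ncard ≤ ∑ C : G.ConnectedComponent, (componentEdges G C).ncard := by
    have hu : G.edgeSet ⊆ ⋃ C : G.ConnectedComponent, componentEdges G C := by
      intro e he
      induction e using Sym2.ind with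
      | _ a b =>
        refine Set.mem_iUnion.2 ⟨G.connectedComponentMk a, he, ?_⟩
        intro v hv
        rcases Sym2.mem_iff.1 hv with rfl | rfl
        · rfl
        · exact SimpleGraph.ConnectedComponent.sound (SimpleGraph.Adj.reachable he).symm
    have h1 := Set.ncard_le_ncard hu (Set.toFinite _)
    exact h1.trans (Set.ncard_iUnion_le_of_fintype _)
  have hV : Fintype.card V = ∑ C : G.ConnectedComponent, C.supp.ncard := by
    have := Finset.card_eq_sum_card_fiberwise (s := (Finset.univ : Finset V))
      (t := (Finset.univ : Finset G.ConnectedComponent)) (f := G.connectedComponentMk)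
      (by intro x _; simp)
    rw [← Finset.card_univ, this]
    refine Finset.sum_congr rfl fun C _ => ?_
    rw [← Set.ncard_coe_finset]
    congr 1
    ext v
    simp
  have hC : ∀ C : G.ConnectedComponent,
      p * (componentEdges G C).ncard + C.supp.ncard ≤ p * C.supp.ncard := by
    intro C
    have h1 := componentEdges_ncard_add_one_le G hG C
    have h2 := hlast C
    obtain ⟨k, hk⟩ := Nat.exists_eq_add_of_le h1
    obtain ⟨j, hj⟩ := Nat.exists_eq_add_of_lt h2
    rw [hk]
    nlinarith [Nat.zero_le (j * k), Nat.zero_le ((componentEdges G C).ncard * k)]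
  have hs := Finset.sum_le_sum fun C (_ : C ∈ Finset.univ) => hC C
  rw [Finset.sum_add_distrib, ← Finset.mul_sum, ← Finset.mul_sum, ← hV] at hs
  have := Nat.mul_le_mul_left p hE
  omega

/-- Let `F 0` be a forest with `n` vertices and `m` edges, `1 ≤ p ≤ n − 1`,
and let `F i`, `0 ≤ i ≤ l`, be a sequence of forests with `E_i ⊆ E_{i−1}` and
`|E_i| = |E_{i−1}| − p`, such that every connected component of `F l` has fewer than `p`
edges. If `m > n·(p−1)/p`, then `l ≥ ⌈(1/p)·(m − n·(p−1)/p)⌉`. -/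
theorem forest_sequence_length_lower_bound {V : Type*} [Fintype V] (p l : ℕ)
    (hp1 : 1 ≤ p) (hp2 : p ≤ Fintype.card V - 1)
    (F : ℕ → SimpleGraph V) (hforest : ∀ i ≤ l, (F i).IsAcyclic)
    (hsub : ∀ i < l, F (i + 1) ≤ F i)
    (hcard : ∀ i < l, (F i).edgeSet.ncard = (F (i + 1)).edgeSet.ncard + p)
    (hlast : ∀ C : (F l).ConnectedComponent, (componentEdges (F l) C).ncard < p)
    (hm : (Fintype.card V : ℚ) * ((p : ℚ) - 1) / (p : ℚ) < ((F 0).edgeSet.ncard : ℚ)) :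
    ⌈(1 / (p : ℚ)) *
        (((F 0).edgeSet.ncard : ℚ) - (Fintype.card V : ℚ) * ((p : ℚ) - 1) / (p : ℚ))⌉ ≤
      (l : ℤ) := by
  have hE : ∀ i ≤ l, (F 0).edgeSet.ncard = (F i).edgeSet.ncard + i * p := by
    intro i
    induction i with
    | zero => simp
    | succ k ih =>
      intro hk
      rw [ih (by omega), hcard k (by omega)]
      ring
  have h1 := hE l le_rfl
  have h2 := mul_edges_le (F l) p (hforest l le_rfl) hlast
  have hp : (0 : ℚ) < p := by exact_mod_cast hp1
  rw [Int.ceil_le, h1]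
  have h3 : (p : ℚ) * ((F l).edgeSet.ncard : ℚ) + Fintype.card V ≤ p * Fintype.card V := by
    exact_mod_cast h2
  push_cast
  have h4 : ((F l).edgeSet.ncard : ℚ) ≤ (Fintype.card V : ℚ) * ((p : ℚ) - 1) / (p : ℚ) := by
    rw [le_div_iff₀ hp]
    linarith
  rw [one_div, inv_mul_le_iff₀ hp]
  linarith
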